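/- (Structure Theorem for Hopf modules in the Yetter–Drinfeld category.) Let H be a quasi-Hopf algebra over a field k, B a Hopf algebra in the braided category of left Yetter–Drinfeld modules over H, and M a right B-Hopf module in this category. Then the map F : M^coB ⊗ B → M, F(n⊗b) = n←b, is an isomorphism of right B-Hopf modules, where M^coB = {m∈M : ρ_M(m)=m⊗1_B} and M^coB⊗B carries the right B-Hopf module structure (n⊗b)≺b' = ∑X¹·n⊗[(X²·b)(X³·b')] and ρ(n⊗b) = ∑x¹·n⊗x²·b_⟨1⟩⊗x³·b_⟨2⟩. The inverse of F is G(m) = ∑ P(m_⟨0⟩) ⊗ m_⟨1⟩, where P(m)=∑m_⟨0⟩←S̲(m_⟨1⟩). -/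

import Mathlib

open scoped TensorProduct

noncomputable section

/-- A quasi-bialgebra `(H, Δ, ε, Φ)` over a field `k`.  The comultiplication is
given both as an algebra map `Δmap : H →ₐ[k] H ⊗[k] H` and by a finite family of
Sweedler components `Δ1, Δ2` (linked by `Δ_eq`); the reassociator `Φ` and its
inverse are given by finite families of components `X1, X2, X3` resp. `x1, x2, x3`. -/
structure QuasiBialgebra (k H : Type) [Field k] [Ring H] [Algebra k H] where
  /-- index type for the Sweedler components of `Δ` -/
  J : Type
  [fJ : Fintype J]
  Δ1 : H → J → H
  Δ2 : H → J → H
  Δmap : H →ₐ[k] H ⊗[k] H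
  ε : H →ₐ[k] k
  Δ_eq : ∀ h, Δmap h = ∑ j, Δ1 h j ⊗ₜ[k] Δ2 h j
  /-- index type for the components of `Φ` -/
  I : Type
  [fI : Fintype I]
  X1 : I → H
  X2 : I → H
  X3 : I → H
  /-- index type for the components of `Φ⁻¹` -/
  I' : Type
  [fI' : Fintype I']
  x1 : I' → H
  x2 : I' → H
  x3 : I' → H
  Φ_right_inv :
    (∑ i, X1 i ⊗ₜ[k] (X2 i ⊗ₜ[k] X3 i)) * (∑ a, x1 a ⊗ₜ[k] (x2 a ⊗ₜ[k] x3 a)) = 1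
  Φ_left_inv :
    (∑ a, x1 a ⊗ₜ[k] (x2 a ⊗ₜ[k] x3 a)) * (∑ i, X1 i ⊗ₜ[k] (X2 i ⊗ₜ[k] X3 i)) = 1
  quasi_coassoc : ∀ h,
    ∑ j, ∑ j', Δ1 h j ⊗ₜ[k] (Δ1 (Δ2 h j) j' ⊗ₜ[k] Δ2 (Δ2 h j) j')
      = (∑ i, X1 i ⊗ₜ[k] (X2 i ⊗ₜ[k] X3 i))
        * (∑ j, ∑ j', Δ1 (Δ1 h j) j' ⊗ₜ[k] (Δ2 (Δ1 h j) j' ⊗ₜ[k] Δ2 h j))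
        * (∑ a, x1 a ⊗ₜ[k] (x2 a ⊗ₜ[k] x3 a))
  counit_right : ∀ h, ∑ j, ε (Δ2 h j) • Δ1 h j = h
  counit_left : ∀ h, ∑ j, ε (Δ1 h j) • Δ2 h j = h
  cocycle :
    (∑ i, (1 : H) ⊗ₜ[k] (X1 i ⊗ₜ[k] (X2 i ⊗ₜ[k] X3 i)))
      * (∑ i, ∑ j, X1 i ⊗ₜ[k] (Δ1 (X2 i) j ⊗ₜ[k] (Δ2 (X2 i) j ⊗ₜ[k] X3 i)))
      * (∑ i, X1 i ⊗ₜ[k] (X2 i ⊗ₜ[k] (X3 i ⊗ₜ[k] (1 : H))))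
    = (∑ i, ∑ j, X1 i ⊗ₜ[k] (X2 i ⊗ₜ[k] (Δ1 (X3 i) j ⊗ₜ[k] Δ2 (X3 i) j)))
      * (∑ i, ∑ j, Δ1 (X1 i) j ⊗ₜ[k] (Δ2 (X1 i) j ⊗ₜ[k] (X2 i ⊗ₜ[k] X3 i)))
  Φ_normal : ∑ i, ε (X2 i) • (X1 i ⊗ₜ[k] X3 i) = (1 : H ⊗[k] H)

attribute [instance] QuasiBialgebra.fJ QuasiBialgebra.fI QuasiBialgebra.fI'

/-- A quasi-Hopf algebra: a quasi-bialgebra together with a bijective algebra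
anti-automorphism `S` (with inverse `Sinv`) and elements `α, β` satisfying the
antipode axioms. -/
structure QuasiHopf (k H : Type) [Field k] [Ring H] [Algebra k H] extends
    QuasiBialgebra k H where
  S : H →ₗ[k] H
  Sinv : H →ₗ[k] H
  Sinv_S : ∀ h, Sinv (S h) = h
  S_Sinv : ∀ h, S (Sinv h) = h
  S_one : S 1 = 1
  S_mul : ∀ a b, S (a * b) = S b * S a
  α : H
  β : H
  antipode₁ : ∀ h, ∑ j, S (Δ1 h j) * α * Δ2 h j = ε h • α
  antipode₂ : ∀ h, ∑ j, Δ1 h j * β * S (Δ2 h j) = ε h • β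
  antipode₃ : ∑ i, X1 i * β * S (X2 i) * α * X3 i = 1
  antipode₄ : ∑ a, S (x1 a) * α * x2 a * β * S (x3 a) = 1

namespace QuasiHopf

variable {k H : Type} [Field k] [Ring H] [Algebra k H] (Q : QuasiHopf k H)

/-- index type for `∑ A¹⊗A²⊗A³⊗A⁴ = (Φ⊗1)(Δ⊗id⊗id)(Φ⁻¹)` -/
abbrev AIdx := Q.I × Q.I' × Q.J

def A1 (t : Q.AIdx) : H := Q.X1 t.1 * Q.Δ1 (Q.x1 t.2.1) t.2.2
def A2 (t : Q.AIdx) : H := Q.X2 t.1 * Q.Δ2 (Q.x1 t.2.1) t.2.2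
def A3 (t : Q.AIdx) : H := Q.X3 t.1 * Q.x2 t.2.1
def A4 (t : Q.AIdx) : H := Q.x3 t.2.1

/-- index type for `∑ B¹⊗B²⊗B³⊗B⁴ = (Δ⊗id⊗id)(Φ)(Φ⁻¹⊗1)` -/
abbrev BIdx := Q.I × Q.J × Q.I'

def B1 (t : Q.BIdx) : H := Q.Δ1 (Q.X1 t.1) t.2.1 * Q.x1 t.2.2
def B2 (t : Q.BIdx) : H := Q.Δ2 (Q.X1 t.1) t.2.1 * Q.x2 t.2.2
def B3 (t : Q.BIdx) : H := Q.X2 t.1 * Q.x3 t.2.2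
def B4 (t : Q.BIdx) : H := Q.X3 t.1

/-- `γ = ∑ S(A²)αA³ ⊗ S(A¹)αA⁴` -/
def gam1 (t : Q.AIdx) : H := Q.S (Q.A2 t) * Q.α * Q.A3 t
def gam2 (t : Q.AIdx) : H := Q.S (Q.A1 t) * Q.α * Q.A4 t

/-- `δ = ∑ B¹βS(B⁴) ⊗ B²βS(B³)` -/
def del1 (t : Q.BIdx) : H := Q.B1 t * Q.β * Q.S (Q.B4 t)
def del2 (t : Q.BIdx) : H := Q.B2 t * Q.β * Q.S (Q.B3 t)

/-- index type for the components of the Drinfeld twist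
`f = ∑ (S⊗S)(Δᵒᵖ(x¹)) γ Δ(x²βS(x³))` -/
abbrev FIdx := Q.I' × Q.J × Q.AIdx × Q.J

def f1 (t : Q.FIdx) : H :=
  Q.S (Q.Δ2 (Q.x1 t.1) t.2.1) * Q.gam1 t.2.2.1
    * Q.Δ1 (Q.x2 t.1 * Q.β * Q.S (Q.x3 t.1)) t.2.2.2
def f2 (t : Q.FIdx) : H :=
  Q.S (Q.Δ1 (Q.x1 t.1) t.2.1) * Q.gam2 t.2.2.1
    * Q.Δ2 (Q.x2 t.1 * Q.β * Q.S (Q.x3 t.1)) t.2.2.2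

/-- index type for the components of
`f⁻¹ = ∑ Δ(S(x¹)αx²) δ (S⊗S)(Δᵒᵖ(x³))` -/
abbrev GIdx := Q.I' × Q.J × Q.BIdx × Q.J

def g1 (t : Q.GIdx) : H :=
  Q.Δ1 (Q.S (Q.x1 t.1) * Q.α * Q.x2 t.1) t.2.1 * Q.del1 t.2.2.1
    * Q.S (Q.Δ2 (Q.x3 t.1) t.2.2.2)
def g2 (t : Q.GIdx) : H :=
  Q.Δ2 (Q.S (Q.x1 t.1) * Q.α * Q.x2 t.1) t.2.1 * Q.del2 t.2.2.1
    * Q.S (Q.Δ1 (Q.x3 t.1) t.2.2.2)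

/-- `q_R = ∑ X¹ ⊗ S⁻¹(αX³)X²` -/
def q1 (i : Q.I) : H := Q.X1 i
def q2 (i : Q.I) : H := Q.Sinv (Q.α * Q.X3 i) * Q.X2 i

/-- `p_R = ∑ x¹ ⊗ x²βS(x³)` -/
def p1 (a : Q.I') : H := Q.x1 a
def p2 (a : Q.I') : H := Q.x2 a * Q.β * Q.S (Q.x3 a)

/-- `p_L = ∑ X²S⁻¹(X¹β) ⊗ X³` -/
def pL1 (i : Q.I) : H := Q.X2 i * Q.Sinv (Q.X1 i * Q.β)
def pL2 (i : Q.I) : H := Q.X3 i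

/-- `q_L = ∑ S(x¹)αx² ⊗ x³` -/
def qL1 (a : Q.I') : H := Q.S (Q.x1 a) * Q.α * Q.x2 a
def qL2 (a : Q.I') : H := Q.x3 a

end QuasiHopf

section BraidedYD

variable {k H : Type} [Field k] [Ring H] [Algebra k H]

/-- the linear map `h ↦ A * h * C` on `H` -/
def lrH (k : Type) [Field k] {H : Type} [Ring H] [Algebra k H] (A C : H) :
    H →ₗ[k] H :=
  (LinearMap.mulLeft k A).comp (LinearMap.mulRight k C)

/-- the linear map `h ⊗ h' ↦ A * h * C * h' * E` on `H ⊗ H` -/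
def sandwichLift (k : Type) [Field k] {H : Type} [Ring H] [Algebra k H]
    (A C E : H) : H ⊗[k] H →ₗ[k] H :=
  TensorProduct.lift
    (((LinearMap.mul k H).compl₂ (LinearMap.mulRight k E)).comp
      ((LinearMap.mulLeft k A).comp (LinearMap.mulRight k C)))

variable {M : Type} [AddCommGroup M] [Module k M]

/-- A left Yetter-Drinfeld module over a quasi-bialgebra `Q`: a left `H`-module
(action `act`) with a left `H`-coaction `coact : M →ₗ H ⊗ M`,
`m ↦ ∑ m₍₋₁₎ ⊗ m₍₀₎`, satisfying (y1), (y2), (y3). -/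
structure IsLeftYD (Q : QuasiBialgebra k H)
    (act : H →ₗ[k] M →ₗ[k] M) (coact : M →ₗ[k] H ⊗[k] M) : Prop where
  one_act : act 1 = LinearMap.id
  mul_act : ∀ g h, act (g * h) = (act g).comp (act h)
  /-- `∑ X¹m₍₋₁₎ ⊗ (X²·m₍₀₎)₍₋₁₎X³ ⊗ (X²·m₍₀₎)₍₀₎
      = ∑ X¹(Y¹·m)₍₋₁₎₁Y² ⊗ X²(Y¹·m)₍₋₁₎₂Y³ ⊗ X³·(Y¹·m)₍₀₎` -/
  yd1 : ∀ m,
    ∑ i, (TensorProduct.map (LinearMap.mulLeft k (Q.X1 i))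
        (TensorProduct.map (LinearMap.mulRight k (Q.X3 i)) LinearMap.id))
        ((LinearMap.lTensor H (coact.comp (act (Q.X2 i)))) (coact m))
    = ∑ i, ∑ i2, (TensorProduct.assoc k H H M)
        ((TensorProduct.map
          (TensorProduct.map (lrH k (Q.X1 i) (Q.X2 i2)) (lrH k (Q.X2 i) (Q.X3 i2)))
          (act (Q.X3 i)))
          ((LinearMap.rTensor M Q.Δmap.toLinearMap) (coact (act (Q.X1 i2) m))))
  /-- `∑ ε(m₍₋₁₎) m₍₀₎ = m` -/
  yd2 : ∀ m,
    (TensorProduct.lid k M) ((LinearMap.rTensor M Q.ε.toLinearMap) (coact m)) = m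
  /-- `∑ h₁m₍₋₁₎ ⊗ h₂·m₍₀₎ = ∑ (h₁·m)₍₋₁₎h₂ ⊗ (h₁·m)₍₀₎` -/
  yd3 : ∀ h m,
    ∑ j, (TensorProduct.map (LinearMap.mulLeft k (Q.Δ1 h j)) (act (Q.Δ2 h j))) (coact m)
    = ∑ j, (LinearMap.rTensor M (LinearMap.mulRight k (Q.Δ2 h j)))
        (coact (act (Q.Δ1 h j) m))

/-- The data of a bialgebra `B` in the braided category of left Yetter-Drinfeld
modules over a quasi-bialgebra `Q`: the `H`-action, the `H`-coaction (as a linear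
map and via a finite family of components `cm1, cm0`), the multiplication, unit,
comultiplication (as a linear map and via components `D1, D2`) and counit. -/
structure BialgData {k H : Type} [Field k] [Ring H] [Algebra k H]
    (Q : QuasiBialgebra k H) (B : Type) [AddCommGroup B] [Module k B] where
  act : H →ₗ[k] B →ₗ[k] B
  coact : B →ₗ[k] H ⊗[k] B
  /-- index type for the components of the `H`-coaction -/
  KB : Type
  [fKB : Fintype KB]
  cm1 : B → KB → H
  cm0 : B → KB → B
  mul : B →ₗ[k] B →ₗ[k] B
  one : B
  comul : B →ₗ[k] B ⊗[k] B
  /-- index type for the components of the comultiplication -/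
  LB : Type
  [fLB : Fintype LB]
  D1 : B → LB → B
  D2 : B → LB → B
  counit : B →ₗ[k] k

attribute [instance] BialgData.fKB BialgData.fLB

variable {B : Type} [AddCommGroup B] [Module k B]

/-- `B` (with data `D`) is a bialgebra in the braided category of left
Yetter-Drinfeld modules over `Q`. -/
structure IsBialgebraInYD (Q : QuasiBialgebra k H) (D : BialgData Q B) : Prop where
  yd : IsLeftYD Q D.act D.coact
  coact_eq : ∀ b, D.coact b = ∑ κ, D.cm1 b κ ⊗ₜ[k] D.cm0 b κ
  comul_eq : ∀ b, D.comul b = ∑ l, D.D1 b l ⊗ₜ[k] D.D2 b l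
  /-- `(ab)c = ∑ (X¹·a)[(X²·b)(X³·c)]` -/
  mul_assoc : ∀ a b c, D.mul (D.mul a b) c
    = ∑ i, D.mul (D.act (Q.X1 i) a) (D.mul (D.act (Q.X2 i) b) (D.act (Q.X3 i) c))
  one_mul : ∀ b, D.mul D.one b = b
  mul_one : ∀ b, D.mul b D.one = b
  /-- `h·(ab) = ∑ (h₁·a)(h₂·b)` -/
  act_mul : ∀ h a b, D.act h (D.mul a b)
    = ∑ j, D.mul (D.act (Q.Δ1 h j) a) (D.act (Q.Δ2 h j) b)
  act_one : ∀ h, D.act h D.one = Q.ε h • D.one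
  /-- `λ_B(bb') = ∑ X¹(x¹Y¹·b)₍₋₁₎x²(Y²·b')₍₋₁₎Y³
        ⊗ [X²·(x¹Y¹·b)₍₀₎][X³x³·(Y²·b')₍₀₎]` -/
  coact_mul : ∀ b b', D.coact (D.mul b b')
    = ∑ i, ∑ a, ∑ i2, ∑ κ, ∑ κ',
        (Q.X1 i * D.cm1 (D.act (Q.x1 a * Q.X1 i2) b) κ * Q.x2 a
            * D.cm1 (D.act (Q.X2 i2) b') κ' * Q.X3 i2)
          ⊗ₜ[k] D.mul (D.act (Q.X2 i) (D.cm0 (D.act (Q.x1 a * Q.X1 i2) b) κ))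
            (D.act (Q.X3 i * Q.x3 a) (D.cm0 (D.act (Q.X2 i2) b') κ'))
  coact_one : D.coact D.one = (1 : H) ⊗ₜ[k] D.one
  /-- `∑ X¹·b₍1,1₎ ⊗ X²·b₍1,2₎ ⊗ X³·b₍2₎ = ∑ b₍1₎ ⊗ b₍2,1₎ ⊗ b₍2,2₎` -/
  comul_coassoc : ∀ b,
    ∑ i, (TensorProduct.map (TensorProduct.map (D.act (Q.X1 i)) (D.act (Q.X2 i)))
        (D.act (Q.X3 i))) ((LinearMap.rTensor B D.comul) (D.comul b))
    = (TensorProduct.assoc k B B B).symm ((LinearMap.lTensor B D.comul) (D.comul b))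
  comul_act : ∀ h b, D.comul (D.act h b)
    = ∑ j, (TensorProduct.map (D.act (Q.Δ1 h j)) (D.act (Q.Δ2 h j))) (D.comul b)
  counit_act : ∀ h b, D.counit (D.act h b) = Q.ε h * D.counit b
  comul_counit_right : ∀ b,
    (TensorProduct.rid k B) ((LinearMap.lTensor B D.counit) (D.comul b)) = b
  comul_counit_left : ∀ b,
    (TensorProduct.lid k B) ((LinearMap.rTensor B D.counit) (D.comul b)) = b
  /-- `Δ_B` is `H`-colinear -/
  comul_colinear : ∀ b, (LinearMap.lTensor H D.comul) (D.coact b)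
    = ∑ i, ∑ a, ∑ i2, ∑ l, ∑ κ, ∑ κ',
        (Q.X1 i * D.cm1 (D.act (Q.x1 a * Q.X1 i2) (D.D1 b l)) κ * Q.x2 a
            * D.cm1 (D.act (Q.X2 i2) (D.D2 b l)) κ' * Q.X3 i2)
          ⊗ₜ[k] ((D.act (Q.X2 i) (D.cm0 (D.act (Q.x1 a * Q.X1 i2) (D.D1 b l)) κ))
            ⊗ₜ[k] (D.act (Q.X3 i * Q.x3 a) (D.cm0 (D.act (Q.X2 i2) (D.D2 b l)) κ')))
  /-- `∑ ε_B(b₍₀₎) b₍₋₁₎ = ε_B(b) 1` -/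
  counit_colinear : ∀ b, ∑ κ, D.counit (D.cm0 b κ) • D.cm1 b κ = D.counit b • (1 : H)
  comul_one : D.comul D.one = D.one ⊗ₜ[k] D.one
  /-- braided multiplicativity of `Δ_B`:
  `Δ_B(bb') = ∑ [y¹X¹·b₍1₎][y²Y¹(x¹X²·b₍2₎)₍₋₁₎x²X³₁·b'₍1₎]
      ⊗ [y³₁Y²·(x¹X²·b₍2₎)₍₀₎][y³₂Y³x³X³₂·b'₍2₎]` -/
  comul_mul : ∀ b b', D.comul (D.mul b b')
    = ∑ a, ∑ i, ∑ i2, ∑ a2, ∑ j, ∑ j2, ∑ l, ∑ l', ∑ κ,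
        D.mul (D.act (Q.x1 a * Q.X1 i) (D.D1 b l))
          (D.act (Q.x2 a * Q.X1 i2 * D.cm1 (D.act (Q.x1 a2 * Q.X2 i) (D.D2 b l)) κ
              * Q.x2 a2 * Q.Δ1 (Q.X3 i) j) (D.D1 b' l'))
        ⊗ₜ[k] D.mul
          (D.act (Q.Δ1 (Q.x3 a) j2 * Q.X2 i2)
            (D.cm0 (D.act (Q.x1 a2 * Q.X2 i) (D.D2 b l)) κ))
          (D.act (Q.Δ2 (Q.x3 a) j2 * Q.X3 i2 * Q.x3 a2 * Q.Δ2 (Q.X3 i) j) (D.D2 b' l'))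

/-- `B` (with data `D` and antipode `Sb`) is a Hopf algebra in the braided
category of left Yetter-Drinfeld modules over `Q`. -/
structure IsBraidedHopf (Q : QuasiBialgebra k H) (D : BialgData Q B)
    (Sb : B →ₗ[k] B) : Prop where
  bialg : IsBialgebraInYD Q D
  antipode_Hlinear : ∀ h b, Sb (D.act h b) = D.act h (Sb b)
  antipode_colinear : ∀ b, D.coact (Sb b) = (LinearMap.lTensor H Sb) (D.coact b)
  antipode_left : ∀ b, ∑ l, D.mul (Sb (D.D1 b l)) (D.D2 b l) = D.counit b • D.one
  antipode_right : ∀ b, ∑ l, D.mul (D.D1 b l) (Sb (D.D2 b l)) = D.counit b • D.one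

/-- `M` is a right `B`-Hopf module in the braided category of left
Yetter-Drinfeld modules over `Q`:  a Yetter-Drinfeld module `(actM, coactM)`
with an `H`-linear, `H`-colinear right `B`-action `ract` and an `H`-linear,
`H`-colinear, counital, quasi-coassociative right `B`-coaction `rcoact` which is
right `B`-linear in the braided sense. -/
structure IsRightBHopfModule (Q : QuasiBialgebra k H) (D : BialgData Q B)
    (actM : H →ₗ[k] M →ₗ[k] M) (coactM : M →ₗ[k] H ⊗[k] M)
    (ract : B →ₗ[k] M →ₗ[k] M) (rcoact : M →ₗ[k] M ⊗[k] B) : Prop where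
  yd : IsLeftYD Q actM coactM
  /-- `m ← 1_B = m` -/
  ract_one : ∀ m, ract D.one m = m
  /-- `(m←b)←b' = ∑ (X¹·m)←[(X²·b)(X³·b')]` -/
  ract_assoc : ∀ m b b', ract b' (ract b m)
    = ∑ i, ract (D.mul (D.act (Q.X2 i) b) (D.act (Q.X3 i) b')) (actM (Q.X1 i) m)
  /-- `h·(m←b) = ∑ (h₁·m)←(h₂·b)` -/
  ract_Hlinear : ∀ h b m, actM h (ract b m)
    = ∑ j, ract (D.act (Q.Δ2 h j) b) (actM (Q.Δ1 h j) m)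
  /-- `λ_M(m←b) = ∑ X¹(x¹Y¹·m)₍₋₁₎x²(Y²·b)₍₋₁₎Y³
      ⊗ [X²·(x¹Y¹·m)₍₀₎]←[X³x³·(Y²·b)₍₀₎]` -/
  ract_Hcolinear : ∀ m b, coactM (ract b m)
    = ∑ i, ∑ a, ∑ i2, ∑ κ,
        (TensorProduct.map
          (lrH k (Q.X1 i) (Q.x2 a * D.cm1 (D.act (Q.X2 i2) b) κ * Q.X3 i2))
          ((ract (D.act (Q.X3 i * Q.x3 a) (D.cm0 (D.act (Q.X2 i2) b) κ))).comp
            (actM (Q.X2 i))))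
          (coactM (actM (Q.x1 a * Q.X1 i2) m))
  /-- `ρ_M(h·m) = ∑ h₁·m₍0₎ ⊗ h₂·m₍1₎` -/
  rcoact_Hlinear : ∀ h m, rcoact (actM h m)
    = ∑ j, (TensorProduct.map (actM (Q.Δ1 h j)) (D.act (Q.Δ2 h j))) (rcoact m)
  /-- `∑ m₍₋₁₎ ⊗ ρ_M(m₍₀₎) = ∑ X¹(x¹Y¹·m₍0₎)₍₋₁₎x²(Y²·m₍1₎)₍₋₁₎Y³
      ⊗ X²·(x¹Y¹·m₍0₎)₍₀₎ ⊗ X³x³·(Y²·m₍1₎)₍₀₎` -/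
  rcoact_Hcolinear : ∀ m, (LinearMap.lTensor H rcoact) (coactM m)
    = ∑ i, ∑ a, ∑ i2,
        (TensorProduct.map (sandwichLift k (Q.X1 i) (Q.x2 a) (Q.X3 i2))
          (TensorProduct.map (actM (Q.X2 i)) (D.act (Q.X3 i * Q.x3 a))))
          ((TensorProduct.tensorTensorTensorComm k H M H B)
            ((TensorProduct.map (coactM.comp (actM (Q.x1 a * Q.X1 i2)))
              (D.coact.comp (D.act (Q.X2 i2)))) (rcoact m)))
  /-- `∑ X¹·m₍0,0₎ ⊗ X²·m₍0,1₎ ⊗ X³·m₍1₎ = ∑ m₍0₎ ⊗ (m₍1₎)₍1₎ ⊗ (m₍1₎)₍2₎` -/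
  rcoact_coassoc : ∀ m,
    ∑ i, (TensorProduct.map (TensorProduct.map (actM (Q.X1 i)) (D.act (Q.X2 i)))
        (D.act (Q.X3 i))) ((LinearMap.rTensor B rcoact) (rcoact m))
    = (TensorProduct.assoc k M B B).symm ((LinearMap.lTensor M D.comul) (rcoact m))
  /-- `∑ ε_B(m₍1₎) m₍0₎ = m` -/
  rcoact_counit : ∀ m,
    (TensorProduct.rid k M) ((LinearMap.lTensor M D.counit) (rcoact m)) = m
  /-- `ρ_M(m←b) = ∑ (y¹X¹·m₍0₎)←[y²Y¹(x¹X²·m₍1₎)₍₋₁₎x²X³₁·b₍1₎]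
      ⊗ [y³₁Y²·(x¹X²·m₍1₎)₍₀₎][y³₂Y³x³X³₂·b₍2₎]` -/
  rcoact_ract : ∀ m b, rcoact (ract b m)
    = ∑ a, ∑ i, ∑ i2, ∑ a2, ∑ j, ∑ j2, ∑ l,
        (TensorProduct.map
          (TensorProduct.lift
            (((ract.comp ((D.act.flip (D.D1 b l)).comp
                (lrH k (Q.x2 a * Q.X1 i2) (Q.x2 a2 * Q.Δ1 (Q.X3 i) j)))).flip).comp
              (actM (Q.x1 a * Q.X1 i))))
          ((D.mul.flip (D.act (Q.Δ2 (Q.x3 a) j2 * Q.X3 i2 * Q.x3 a2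
              * Q.Δ2 (Q.X3 i) j) (D.D2 b l))).comp
            (D.act (Q.Δ1 (Q.x3 a) j2 * Q.X2 i2))))
          ((TensorProduct.assoc k M H B).symm
            ((LinearMap.lTensor M (D.coact.comp (D.act (Q.x1 a2 * Q.X2 i))))
              (rcoact m)))

end BraidedYD

section HopfModuleCoinv

variable {k H : Type} [Field k] [Ring H] [Algebra k H]
variable {Q : QuasiBialgebra k H}
variable {B : Type} [AddCommGroup B] [Module k B]
variable {M : Type} [AddCommGroup M] [Module k M]

/-- the coinvariants `M^{co B} = {m ∈ M | ρ_M(m) = m ⊗ 1_B}` of a right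
`B`-Hopf module -/
def coinvariants (D : BialgData Q B) (rcoact : M →ₗ[k] M ⊗[k] B) :
    Submodule k M :=
  LinearMap.ker (rcoact - (TensorProduct.mk k M B).flip D.one)

/-- the projection `P(m) = ∑ m₍0₎ ← S̲(m₍1₎)` of a right `B`-Hopf module -/
def coinvProj (Sb : B →ₗ[k] B) (ract : B →ₗ[k] M →ₗ[k] M)
    (rcoact : M →ₗ[k] M ⊗[k] B) : M →ₗ[k] M :=
  (TensorProduct.lift ((ract.comp Sb).flip)).comp rcoact

end HopfModuleCoinv

open CategoryTheory MonoidalCategory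

section Abstract
variable {C : Type*} [Category C] [MonoidalCategory C]

/-- The diagonal right action `(m ⊗ b) ⊗ b' ↦ m ← (b₍₋₁₎ b'₁) ⊗ b₍₀₎ b'₂` of `B` on `M ⊗ B`,
with `c` in the role of the braiding. -/
def diagAction {M B : C} (c : B ⊗ B ⟶ B ⊗ B) (Δ : B ⟶ B ⊗ B) (μ : B ⊗ B ⟶ B) (r : M ⊗ B ⟶ M) :
    (M ⊗ B) ⊗ B ⟶ M ⊗ B :=
  (α_ M B B).hom ≫ M ◁ (B ◁ Δ ≫ (α_ B B B).inv ≫ c ▷ B ≫ (α_ B B B).hom) ≫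
    (α_ M B (B ⊗ B)).inv ≫ r ▷ (B ⊗ B) ≫ M ◁ μ

/-- The map `m ⊗ b ↦ (m ← b₁) ⊗ b₂`. -/
def freeCoaction {M B : C} (Δ : B ⟶ B ⊗ B) (r : M ⊗ B ⟶ M) : M ⊗ B ⟶ M ⊗ B :=
  M ◁ Δ ≫ (α_ M B B).inv ≫ r ▷ B

/-- A right Hopf module in a monoidal category over a Hopf algebra `B`, in which only the braiding
`c` of `B` with itself is used. -/
structure HopfModuleIn {M B : C} (c : B ⊗ B ⟶ B ⊗ B) (μ : B ⊗ B ⟶ B) (η : 𝟙_ C ⟶ B)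
    (Δ : B ⟶ B ⊗ B) (ε : B ⟶ 𝟙_ C) (S : B ⟶ B) (r : M ⊗ B ⟶ M) (ρ : M ⟶ M ⊗ B) : Prop where
  unit_braid : η ▷ B ≫ c = (λ_ B).hom ≫ (ρ_ B).inv ≫ B ◁ η
  one_mul : η ▷ B ≫ μ = (λ_ B).hom
  counit_comul : Δ ≫ ε ▷ B = (λ_ B).inv
  unit_comul : η ≫ Δ = (λ_ (𝟙_ C)).inv ≫ (η ⊗ₘ η)
  mul_comul : μ ≫ Δ = Δ ▷ B ≫ diagAction c Δ μ μ
  antipode_left : Δ ≫ S ▷ B ≫ μ = ε ≫ η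
  antipode_right : Δ ≫ B ◁ S ≫ μ = ε ≫ η
  act_assoc : r ▷ B ≫ r = (α_ M B B).hom ≫ M ◁ μ ≫ r
  act_unit : M ◁ η ≫ r = (ρ_ M).hom
  coact_coassoc : ρ ≫ ρ ▷ B ≫ (α_ M B B).hom = ρ ≫ M ◁ Δ
  coact_counit : ρ ≫ M ◁ ε = (ρ_ M).inv
  coact_act : r ≫ ρ = ρ ▷ B ≫ diagAction c Δ μ r

namespace HopfModuleIn

variable {M B : C} {c : B ⊗ B ⟶ B ⊗ B} {μ : B ⊗ B ⟶ B} {η : 𝟙_ C ⟶ B}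
    {Δ : B ⟶ B ⊗ B} {ε : B ⟶ 𝟙_ C} {S : B ⟶ B} {r : M ⊗ B ⟶ M} {ρ : M ⟶ M ⊗ B}

/-- `m ↦ m ⊗ 1`. -/
abbrev tmulUnit (M : C) {B : C} (η : 𝟙_ C ⟶ B) : M ⟶ M ⊗ B := (ρ_ M).inv ≫ M ◁ η

/-- The projection `m ↦ m₀ ← S(m₁)`. -/
def proj (S : B ⟶ B) (r : M ⊗ B ⟶ M) (ρ : M ⟶ M ⊗ B) : M ⟶ M := ρ ≫ M ◁ S ≫ r

theorem freeCoaction_diagAction (h : HopfModuleIn c μ η Δ ε S r ρ) :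
    freeCoaction Δ r ▷ B ≫ diagAction c Δ μ r = (α_ M B B).hom ≫ M ◁ μ ≫ freeCoaction Δ r := by
  calc freeCoaction Δ r ▷ B ≫ diagAction c Δ μ r
      = (M ◁ Δ) ▷ B ≫ (α_ M B B).inv ▷ B ≫ (α_ (M ⊗ B) B B).hom ≫
          (M ⊗ B) ◁ (B ◁ Δ ≫ (α_ B B B).inv ≫ c ▷ B ≫ (α_ B B B).hom) ≫
          (α_ (M ⊗ B) B (B ⊗ B)).inv ≫ (r ▷ B ≫ r) ▷ (B ⊗ B) ≫ M ◁ μ := by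
        simp only [freeCoaction, diagAction, comp_whiskerRight, Category.assoc]
        rw [associator_naturality_left_assoc, ← whisker_exchange_assoc]
        simp
    _ = (α_ M B B).hom ≫ M ◁ Δ ▷ B ≫ M ◁ (α_ B B B).hom ≫ M ◁ B ◁ (B ◁ Δ ≫ (α_ B B B).inv ≫
          c ▷ B ≫ (α_ B B B).hom) ≫ M ◁ (α_ B B (B ⊗ B)).inv ≫ M ◁ (μ ▷ (B ⊗ B)) ≫
          (α_ M B (B ⊗ B)).inv ≫ r ▷ (B ⊗ B) ≫ M ◁ μ := by
        rw [h.act_assoc]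
        monoidal
    _ = (α_ M B B).hom ≫ M ◁ (Δ ▷ B ≫ diagAction c Δ μ μ) ≫ (α_ M B B).inv ≫ r ▷ B := by
        rw [← whisker_exchange, diagAction]
        monoidal
    _ = _ := by rw [← h.mul_comul]; simp [freeCoaction]

theorem tmulUnit_diagAction (h : HopfModuleIn c μ η Δ ε S r ρ) :
    tmulUnit M η ▷ B ≫ diagAction c Δ μ r = freeCoaction Δ r := by
  calc tmulUnit M η ▷ B ≫ diagAction c Δ μ r
      = M ◁ ((λ_ B).inv ≫ η ▷ B ≫ B ◁ Δ ≫ (α_ B B B).inv ≫ c ▷ B ≫ (α_ B B B).hom) ≫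
          (α_ M B (B ⊗ B)).inv ≫ r ▷ (B ⊗ B) ≫ M ◁ μ := by
        simp only [tmulUnit, diagAction]
        monoidal
    _ = M ◁ ((λ_ B).inv ≫ 𝟙_ C ◁ Δ ≫ (α_ (𝟙_ C) B B).inv ≫ (η ▷ B ≫ c) ▷ B ≫ (α_ B B B).hom) ≫
          (α_ M B (B ⊗ B)).inv ≫ r ▷ (B ⊗ B) ≫ M ◁ μ := by
        rw [← whisker_exchange_assoc]
        monoidal
    _ = M ◁ Δ ≫ (α_ M B B).inv ≫ (M ⊗ B) ◁ ((λ_ B).inv ≫ η ▷ B ≫ μ) ≫ r ▷ B := by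
        rw [h.unit_braid, ← whisker_exchange]
        monoidal
    _ = _ := by rw [h.one_mul]; simp [freeCoaction]

theorem proj_act (h : HopfModuleIn c μ η Δ ε S r ρ) : ρ ≫ proj S r ρ ▷ B ≫ r = 𝟙 M := by
  calc ρ ≫ proj S r ρ ▷ B ≫ r
      = ρ ≫ ρ ▷ B ≫ (M ◁ S) ▷ B ≫ r ▷ B ≫ r := by simp [proj]
    _ = (ρ ≫ ρ ▷ B ≫ (α_ M B B).hom) ≫ M ◁ (S ▷ B ≫ μ) ≫ r := by rw [h.act_assoc]; simp
    _ = ρ ≫ M ◁ (Δ ≫ S ▷ B ≫ μ) ≫ r := by rw [h.coact_coassoc]; simp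
    _ = 𝟙 M := by
      rw [h.antipode_left, whiskerLeft_comp_assoc, h.act_unit, reassoc_of% h.coact_counit]
      simp

theorem freeCoaction_antipode (h : HopfModuleIn c μ η Δ ε S r ρ) :
    freeCoaction Δ r ≫ M ◁ S ≫ r = M ◁ ε ≫ (ρ_ M).hom := by
  calc freeCoaction Δ r ≫ M ◁ S ≫ r
      = M ◁ Δ ≫ (α_ M B B).inv ≫ (M ⊗ B) ◁ S ≫ r ▷ B ≫ r := by
        rw [whisker_exchange_assoc]; simp [freeCoaction]
    _ = M ◁ (Δ ≫ B ◁ S ≫ μ) ≫ r := by rw [h.act_assoc]; simp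
    _ = _ := by rw [h.antipode_right, whiskerLeft_comp_assoc, h.act_unit]

theorem proj_freeCoaction (h : HopfModuleIn c μ η Δ ε S r ρ) :
    ρ ≫ proj S r ρ ▷ B ≫ freeCoaction Δ r = ρ := by
  calc ρ ≫ proj S r ρ ▷ B ≫ freeCoaction Δ r
      = (ρ ≫ M ◁ Δ) ≫ (α_ M B B).inv ≫ (proj S r ρ ▷ B ≫ r) ▷ B := by
        rw [freeCoaction, ← whisker_exchange_assoc]; simp
    _ = ρ ≫ (ρ ≫ proj S r ρ ▷ B ≫ r) ▷ B := by rw [← h.coact_coassoc]; simp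
    _ = ρ := by rw [h.proj_act]; simp

theorem proj_coinvariant (h : HopfModuleIn c μ η Δ ε S r ρ) :
    proj S r ρ ≫ ρ = proj S r ρ ≫ tmulUnit M η := by
  calc proj S r ρ ≫ ρ
      = ρ ≫ M ◁ S ≫ ρ ▷ B ≫ diagAction c Δ μ r := by simp [proj, h.coact_act]
    _ = ρ ≫ ρ ▷ B ≫ (M ⊗ B) ◁ S ≫ diagAction c Δ μ r := by rw [whisker_exchange_assoc]
    _ = ρ ≫ (ρ ≫ proj S r ρ ▷ B ≫ freeCoaction Δ r) ▷ B ≫ (M ⊗ B) ◁ S ≫ diagAction c Δ μ r := by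
        rw [h.proj_freeCoaction]
    _ = ρ ≫ ρ ▷ B ≫ (M ⊗ B) ◁ S ≫ (proj S r ρ ▷ B) ▷ B ≫ freeCoaction Δ r ▷ B ≫
          diagAction c Δ μ r := by
        rw [← whisker_exchange_assoc]
        simp only [comp_whiskerRight, Category.assoc]
        rw [whisker_exchange_assoc]
    _ = (ρ ≫ ρ ▷ B ≫ (α_ M B B).hom) ≫ M ◁ (B ◁ S ≫ μ) ≫ proj S r ρ ▷ B ≫ freeCoaction Δ r := by
        rw [h.freeCoaction_diagAction, associator_naturality_left_assoc,
          associator_naturality_right_assoc, ← whisker_exchange_assoc (proj S r ρ) μ]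
        simp
    _ = ρ ≫ M ◁ (Δ ≫ B ◁ S ≫ μ) ≫ proj S r ρ ▷ B ≫ freeCoaction Δ r := by
        rw [h.coact_coassoc]; simp
    _ = (ρ_ M).inv ≫ proj S r ρ ▷ _ ≫ M ◁ (η ≫ Δ) ≫ (α_ M B B).inv ≫ r ▷ B := by
        rw [h.antipode_right, whiskerLeft_comp_assoc, reassoc_of% h.coact_counit, freeCoaction,
          whisker_exchange_assoc]
        simp
    _ = proj S r ρ ≫ (ρ_ M).inv ≫ M ◁ (λ_ (𝟙_ C)).inv ≫ M ◁ 𝟙_ C ◁ η ≫ (α_ M (𝟙_ C) B).inv ≫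
          (M ◁ η ≫ r) ▷ B := by
        rw [h.unit_comul, tensorHom_def']
        monoidal
    _ = _ := by rw [h.act_unit]; monoidal

theorem coinvariant_act (h : HopfModuleIn c μ η Δ ε S r ρ) {N : C} {q : N ⟶ M}
    (hq : q ≫ ρ = q ≫ tmulUnit M η) : q ▷ B ≫ r ≫ ρ = q ▷ B ≫ freeCoaction Δ r := by
  rw [h.coact_act, ← h.tmulUnit_diagAction, ← comp_whiskerRight_assoc, hq, comp_whiskerRight_assoc]

theorem coinvariant_act_proj (h : HopfModuleIn c μ η Δ ε S r ρ) {N : C} {q : N ⟶ M}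
    (hq : q ≫ ρ = q ≫ tmulUnit M η) : q ▷ B ≫ r ≫ ρ ≫ proj S r ρ ▷ B = q ▷ B := by
  have key : q ▷ B ≫ r ≫ proj S r ρ = N ◁ ε ≫ (ρ_ N).hom ≫ q := by
    rw [proj, reassoc_of% h.coinvariant_act hq, h.freeCoaction_antipode]
    rw [← whisker_exchange_assoc]; simp
  calc q ▷ B ≫ r ≫ ρ ≫ proj S r ρ ▷ B
      = N ◁ Δ ≫ (α_ N B B).inv ≫ (q ▷ B ≫ r ≫ proj S r ρ) ▷ B := by
        rw [reassoc_of% h.coinvariant_act hq, freeCoaction, Category.assoc,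
          ← whisker_exchange_assoc]
        simp
    _ = N ◁ (Δ ≫ ε ▷ B) ≫ N ◁ (λ_ B).hom ≫ q ▷ B := by rw [key]; simp
    _ = q ▷ B := by rw [h.counit_comul]; simp

end HopfModuleIn
end Abstract

section TensorAction

variable {k H : Type} [Field k] [Ring H] [Algebra k H]

/-- The action of `A ⊗ A'` on `V ⊗ W` obtained from actions of `A` on `V` and of `A'` on `W`. -/
def pairAct {A A' V W : Type} [Ring A] [Algebra k A] [Ring A'] [Algebra k A'] [AddCommGroup V]
    [Module k V] [AddCommGroup W] [Module k W] (f : A →ₐ[k] Module.End k V)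
    (g : A' →ₐ[k] Module.End k W) : A ⊗[k] A' →ₐ[k] Module.End k (V ⊗[k] W) :=
  (Module.endTensorEndAlgHom (R := k) (S := k) (A := k)).comp (Algebra.TensorProduct.map f g)

@[simp]
theorem pairAct_tmul {A A' V W : Type} [Ring A] [Algebra k A] [Ring A'] [Algebra k A']
    [AddCommGroup V] [Module k V] [AddCommGroup W] [Module k W] (f : A →ₐ[k] Module.End k V)
    (g : A' →ₐ[k] Module.End k W) (a : A) (b : A') :
    pairAct f g (a ⊗ₜ b) = TensorProduct.map (f a) (g b) := rfl

namespace QuasiBialgebra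

variable (Q : QuasiBialgebra k H)

/-- The reassociator as an element of `H ⊗ (H ⊗ H)`. -/
def Φ : H ⊗[k] (H ⊗[k] H) := ∑ i, Q.X1 i ⊗ₜ[k] (Q.X2 i ⊗ₜ[k] Q.X3 i)

/-- The inverse of the reassociator as an element of `H ⊗ (H ⊗ H)`. -/
def Φinv : H ⊗[k] (H ⊗[k] H) := ∑ a, Q.x1 a ⊗ₜ[k] (Q.x2 a ⊗ₜ[k] Q.x3 a)

variable {U V W Z : Type} [AddCommGroup U] [Module k U] [AddCommGroup V] [Module k V]
  [AddCommGroup W] [Module k W] [AddCommGroup Z] [Module k Z]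
  (e : H →ₐ[k] Module.End k U) (f : H →ₐ[k] Module.End k V) (g : H →ₐ[k] Module.End k W)
  (l : H →ₐ[k] Module.End k Z)

/-- The action of `H` on a tensor product through `Δ`. -/
def tensorAct : H →ₐ[k] Module.End k (V ⊗[k] W) := (pairAct f g).comp Q.Δmap

theorem tensorAct_apply (h : H) (t : V ⊗[k] W) :
    Q.tensorAct f g h t = ∑ j, TensorProduct.map (f (Q.Δ1 h j)) (g (Q.Δ2 h j)) t := by
  simp [tensorAct, Q.Δ_eq, LinearMap.sum_apply]

theorem tensorAct_tmul (h : H) (v : V) (w : W) :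
    Q.tensorAct f g h (v ⊗ₜ w) = ∑ j, f (Q.Δ1 h j) v ⊗ₜ g (Q.Δ2 h j) w := by
  simp [tensorAct_apply]

/-- The action of `Φ` as an invertible linear map. -/
def actΦ : (V ⊗[k] (W ⊗[k] Z)) ≃ₗ[k] (V ⊗[k] (W ⊗[k] Z)) :=
  LinearEquiv.ofLinearMap (pairAct f (pairAct g l) Q.Φ) (pairAct f (pairAct g l) Q.Φinv)
    (by rw [← Module.End.mul_eq_comp, ← map_mul, Φ, Φinv, Q.Φ_right_inv, map_one]; rfl)
    (by rw [← Module.End.mul_eq_comp, ← map_mul, Φ, Φinv, Q.Φ_left_inv, map_one]; rfl)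

/-- The associativity constraint. -/
def associator : ((V ⊗[k] W) ⊗[k] Z) ≃ₗ[k] (V ⊗[k] (W ⊗[k] Z)) :=
  TensorProduct.assoc k V W Z ≪≫ₗ Q.actΦ f g l

theorem associator_tmul (v : V) (w : W) (z : Z) :
    Q.associator f g l ((v ⊗ₜ w) ⊗ₜ z) =
      ∑ i, f (Q.X1 i) v ⊗ₜ (g (Q.X2 i) w ⊗ₜ l (Q.X3 i) z) := by
  change pairAct f (pairAct g l) Q.Φ (v ⊗ₜ (w ⊗ₜ z)) = _
  simp [Φ, LinearMap.sum_apply]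

theorem associator_symm_tmul (v : V) (w : W) (z : Z) :
    (Q.associator f g l).symm (v ⊗ₜ (w ⊗ₜ z)) =
      ∑ a, (f (Q.x1 a) v ⊗ₜ g (Q.x2 a) w) ⊗ₜ l (Q.x3 a) z := by
  change (TensorProduct.assoc k V W Z).symm (pairAct f (pairAct g l) Q.Φinv (v ⊗ₜ (w ⊗ₜ z))) = _
  simp [Φinv, LinearMap.sum_apply]

theorem associator_comm (h : H) :
    (Q.associator f g l).toLinearMap ∘ₗ Q.tensorAct (Q.tensorAct f g) l h =
      Q.tensorAct f (Q.tensorAct g l) h ∘ₗ (Q.associator f g l).toLinearMap := by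
  set T := pairAct f (pairAct g l) with hT
  have h₁ : Q.tensorAct f (Q.tensorAct g l) h =
      T (∑ j, ∑ j', Q.Δ1 h j ⊗ₜ[k] (Q.Δ1 (Q.Δ2 h j) j' ⊗ₜ[k] Q.Δ2 (Q.Δ2 h j) j')) := by
    ext v w z
    simp [hT, tensorAct_tmul, TensorProduct.tmul_sum, LinearMap.sum_apply]
  have h₂ : (TensorProduct.assoc k V W Z).toLinearMap ∘ₗ Q.tensorAct (Q.tensorAct f g) l h =
      T (∑ j, ∑ j', Q.Δ1 (Q.Δ1 h j) j' ⊗ₜ[k] (Q.Δ2 (Q.Δ1 h j) j' ⊗ₜ[k] Q.Δ2 h j)) ∘ₗ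
        (TensorProduct.assoc k V W Z).toLinearMap := by
    ext v w z
    simp [hT, tensorAct_tmul, TensorProduct.sum_tmul]
  have h₃ : (Q.associator f g l).toLinearMap =
      T Q.Φ ∘ₗ (TensorProduct.assoc k V W Z).toLinearMap := rfl
  rw [h₁, h₃, LinearMap.comp_assoc, h₂, Q.quasi_coassoc, ← LinearMap.comp_assoc,
    ← LinearMap.comp_assoc, ← Module.End.mul_eq_comp, ← Module.End.mul_eq_comp, ← map_mul,
    ← map_mul, mul_assoc _ _ Q.Φ]
  congr 2
  conv_rhs => rw [mul_assoc, Φ, Q.Φ_left_inv, mul_one]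
  rfl

theorem associator_pentagon :
    (Q.associator f g l).toLinearMap.lTensor U ∘ₗ
        (Q.associator e (Q.tensorAct f g) l).toLinearMap ∘ₗ
          (Q.associator e f g).toLinearMap.rTensor Z =
      (Q.associator e f (Q.tensorAct g l)).toLinearMap ∘ₗ
        (Q.associator (Q.tensorAct e f) g l).toLinearMap := by
  ext u v w z
  have := congrArg (fun t => pairAct e (pairAct f (pairAct g l)) t (u ⊗ₜ (v ⊗ₜ (w ⊗ₜ z)))) Q.cocycle
  simp only [map_mul, Module.End.mul_apply] at this
  simpa [associator_tmul, tensorAct_tmul, LinearMap.sum_apply, TensorProduct.sum_tmul,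
    TensorProduct.tmul_sum] using this

theorem associator_natural {V' W' Z' : Type} [AddCommGroup V'] [Module k V']
    [AddCommGroup W'] [Module k W'] [AddCommGroup Z'] [Module k Z']
    {f' : H →ₐ[k] Module.End k V'} {g' : H →ₐ[k] Module.End k W'} {l' : H →ₐ[k] Module.End k Z'}
    (a : V →ₗ[k] V') (b : W →ₗ[k] W') (c : Z →ₗ[k] Z') (ha : ∀ h, a ∘ₗ f h = f' h ∘ₗ a)
    (hb : ∀ h, b ∘ₗ g h = g' h ∘ₗ b) (hc : ∀ h, c ∘ₗ l h = l' h ∘ₗ c) :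
    (Q.associator f' g' l').toLinearMap ∘ₗ TensorProduct.map (TensorProduct.map a b) c =
      TensorProduct.map a (TensorProduct.map b c) ∘ₗ (Q.associator f g l).toLinearMap := by
  ext v w z
  have ha' h v := LinearMap.congr_fun (ha h) v
  have hb' h v := LinearMap.congr_fun (hb h) v
  have hc' h v := LinearMap.congr_fun (hc h) v
  simp only [LinearMap.comp_apply] at ha' hb' hc'
  simp [associator_tmul, ha', hb', hc']

theorem tensorAct_map {V' W' : Type} [AddCommGroup V'] [Module k V'] [AddCommGroup W']
    [Module k W'] {f' : H →ₐ[k] Module.End k V'} {g' : H →ₐ[k] Module.End k W'}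
    (a : V →ₗ[k] V') (b : W →ₗ[k] W') (ha : ∀ h, a ∘ₗ f h = f' h ∘ₗ a)
    (hb : ∀ h, b ∘ₗ g h = g' h ∘ₗ b) (h : H) :
    TensorProduct.map a b ∘ₗ Q.tensorAct f g h = Q.tensorAct f' g' h ∘ₗ TensorProduct.map a b := by
  ext v w
  have ha' h v := LinearMap.congr_fun (ha h) v
  have hb' h v := LinearMap.congr_fun (hb h) v
  simp only [LinearMap.comp_apply] at ha' hb'
  simp [tensorAct_tmul, ha', hb']

/-- The action of `H` on the ground field through `ε`. -/
def unitAct : H →ₐ[k] Module.End k k := (Algebra.ofId k (Module.End k k)).comp Q.ε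

theorem unitAct_apply (h : H) (c : k) : Q.unitAct h c = Q.ε h * c := rfl

theorem lid_comm (h : H) :
    (TensorProduct.lid k V).toLinearMap ∘ₗ Q.tensorAct Q.unitAct f h =
      f h ∘ₗ (TensorProduct.lid k V).toLinearMap := by
  ext v
  conv_rhs => rw [← Q.counit_left h]
  simp [tensorAct_tmul, unitAct_apply]

theorem rid_comm (h : H) :
    (TensorProduct.rid k V).toLinearMap ∘ₗ Q.tensorAct f Q.unitAct h =
      f h ∘ₗ (TensorProduct.rid k V).toLinearMap := by
  ext v
  conv_rhs => rw [← Q.counit_right h]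
  simp [tensorAct_tmul, unitAct_apply]

theorem associator_triangle :
    (TensorProduct.lid k W).toLinearMap.lTensor V ∘ₗ (Q.associator f Q.unitAct g).toLinearMap =
      (TensorProduct.rid k V).toLinearMap.rTensor W := by
  ext v w
  have := congrArg (fun t => pairAct f g t (v ⊗ₜ w)) Q.Φ_normal
  simpa [associator_tmul, unitAct_apply, LinearMap.sum_apply] using this

end QuasiBialgebra
end TensorAction

section RepCategory

variable {k H : Type} [Field k] [Ring H] [Algebra k H]

/-- Left modules over the algebra underlying a quasi-bialgebra. -/
structure QuasiBialgebra.Rep (Q : QuasiBialgebra k H) where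
  carrier : Type
  [addCommGroup : AddCommGroup carrier]
  [module : Module k carrier]
  act : H →ₐ[k] Module.End k carrier

namespace QuasiBialgebra.Rep

variable {Q : QuasiBialgebra k H}

attribute [instance] addCommGroup module

/-- `H`-linear maps. -/
@[ext]
structure Hom (V W : Q.Rep) where
  toLin : V.carrier →ₗ[k] W.carrier
  comm : ∀ h, toLin ∘ₗ V.act h = W.act h ∘ₗ toLin

instance : Category Q.Rep where
  Hom := Hom
  id V := ⟨LinearMap.id, fun _ => rfl⟩
  comp f g := ⟨g.toLin ∘ₗ f.toLin, fun h => by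
    rw [LinearMap.comp_assoc, f.comm, ← LinearMap.comp_assoc, g.comm, LinearMap.comp_assoc]⟩

theorem hom_ext {V W : Q.Rep} {f g : V ⟶ W} (h : f.toLin = g.toLin) : f = g := Hom.ext h

/-- An `H`-linear bijection gives an isomorphism. -/
def isoMk {V W : Q.Rep} (e : V.carrier ≃ₗ[k] W.carrier)
    (comm : ∀ h, e.toLinearMap ∘ₗ V.act h = W.act h ∘ₗ e.toLinearMap) : V ≅ W where
  hom := ⟨e.toLinearMap, comm⟩
  inv := ⟨e.symm.toLinearMap, fun h => LinearMap.ext fun w => by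
    have := LinearMap.congr_fun (comm h) (e.symm w)
    simp only [LinearMap.comp_apply, LinearEquiv.coe_coe, LinearEquiv.apply_symm_apply] at this ⊢
    rw [← this, LinearEquiv.symm_apply_apply]⟩
  hom_inv_id := hom_ext (LinearMap.ext e.symm_apply_apply)
  inv_hom_id := hom_ext (LinearMap.ext e.apply_symm_apply)

instance : MonoidalCategoryStruct Q.Rep where
  tensorObj V W := ⟨V.carrier ⊗[k] W.carrier, Q.tensorAct V.act W.act⟩
  whiskerLeft _ _ _ f := ⟨TensorProduct.map LinearMap.id f.toLin,
    Q.tensorAct_map _ _ _ _ (fun _ => rfl) f.comm⟩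
  whiskerRight f _ := ⟨TensorProduct.map f.toLin LinearMap.id,
    Q.tensorAct_map _ _ _ _ f.comm (fun _ => rfl)⟩
  tensorHom f g := ⟨TensorProduct.map f.toLin g.toLin, Q.tensorAct_map _ _ _ _ f.comm g.comm⟩
  tensorUnit := ⟨k, Q.unitAct⟩
  associator V W Z := isoMk (Q.associator V.act W.act Z.act) (Q.associator_comm _ _ _)
  leftUnitor V := isoMk (TensorProduct.lid k V.carrier) (Q.lid_comm _)
  rightUnitor V := isoMk (TensorProduct.rid k V.carrier) (Q.rid_comm _)

instance : MonoidalCategory Q.Rep where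
  tensorHom_def _ _ := hom_ext (TensorProduct.ext' fun _ _ => rfl)
  id_tensorHom_id _ _ := hom_ext TensorProduct.map_id
  tensorHom_comp_tensorHom _ _ _ _ := hom_ext (TensorProduct.ext' fun _ _ => rfl)
  whiskerLeft_id _ _ := hom_ext TensorProduct.map_id
  id_whiskerRight _ _ := hom_ext TensorProduct.map_id
  associator_naturality f g h := hom_ext
    (Q.associator_natural _ _ _ f.toLin g.toLin h.toLin f.comm g.comm h.comm)
  leftUnitor_naturality f := hom_ext (TensorProduct.ext' fun c v =>
    (map_smul f.toLin c v).symm)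
  rightUnitor_naturality f := hom_ext (TensorProduct.ext' fun v c =>
    (map_smul f.toLin c v).symm)
  pentagon _ _ _ _ := hom_ext (Q.associator_pentagon _ _ _ _)
  triangle _ _ := hom_ext (Q.associator_triangle _ _)

end QuasiBialgebra.Rep
end RepCategory

section Translation

theorem sum_reorder {I I' J L K X : Type} [Fintype I] [Fintype I'] [Fintype J] [Fintype L]
    [Fintype K] [AddCommMonoid X] (f : I' → I → I → I' → J → J → L → K → X) :
    ∑ i, ∑ j, ∑ l, ∑ a', ∑ κ, ∑ i', ∑ a, ∑ j', f a i i' a' j j' l κ =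
      ∑ a, ∑ i, ∑ i', ∑ a', ∑ j, ∑ j', ∑ l, ∑ κ, f a i i' a' j j' l κ := by
  let e : I × J × L × I' × K × I × I' × J ≃ I' × I × I × I' × J × J × L × K :=
    { toFun := fun (i, j, l, a', κ, i', a, j') => (a, i, i', a', j, j', l, κ)
      invFun := fun (a, i, i', a', j, j', l, κ) => (i, j, l, a', κ, i', a, j')
      left_inv := fun _ => rfl
      right_inv := fun _ => rfl }
  have := Fintype.sum_equiv e
    (fun p => f (e p).1 (e p).2.1 (e p).2.2.1 (e p).2.2.2.1 (e p).2.2.2.2.1 (e p).2.2.2.2.2.1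
      (e p).2.2.2.2.2.2.1 (e p).2.2.2.2.2.2.2)
    (fun p => f p.1 p.2.1 p.2.2.1 p.2.2.2.1 p.2.2.2.2.1 p.2.2.2.2.2.1 p.2.2.2.2.2.2.1
      p.2.2.2.2.2.2.2) fun _ => rfl
  simp only [Fintype.sum_prod_type] at this
  exact this

variable {k H : Type} [Field k] [Ring H] [Algebra k H] {Q : QuasiBialgebra k H}
variable {B : Type} [AddCommGroup B] [Module k B] {D : BialgData Q B}
variable {M : Type} [AddCommGroup M] [Module k M]

/-- The action of a Yetter-Drinfeld module as an algebra map. -/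
def IsLeftYD.actHom {act : H →ₗ[k] M →ₗ[k] M} {coact : M →ₗ[k] H ⊗[k] M}
    (h : IsLeftYD Q act coact) : H →ₐ[k] Module.End k M :=
  AlgHom.ofLinearMap act h.one_act h.mul_act

@[simp]
theorem IsLeftYD.actHom_apply {act : H →ₗ[k] M →ₗ[k] M} {coact : M →ₗ[k] H ⊗[k] M}
    (yd : IsLeftYD Q act coact) (h : H) : yd.actHom h = act h := rfl

/-- The braiding `a ⊗ b ↦ ∑ a₍₋₁₎·b ⊗ a₍₀₎` of `B` with itself. -/
def BialgData.braid (D : BialgData Q B) : B ⊗[k] B →ₗ[k] B ⊗[k] B :=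
  (TensorProduct.lift D.act).rTensor B ∘ₗ (TensorProduct.rightComm k H B B).toLinearMap ∘ₗ
    D.coact.rTensor B

theorem BialgData.braid_tmul_eq_rTensor (a b : B) :
    D.braid (a ⊗ₜ b) = (D.act.flip b).rTensor B (D.coact a) := by
  simp only [braid, LinearMap.comp_apply, LinearMap.rTensor_tmul]
  induction D.coact a with
  | zero => simp
  | tmul h b' => simp
  | add x y hx hy => simpa only [TensorProduct.add_tmul, map_add] using congrArg₂ (· + ·) hx hy

namespace IsBialgebraInYD

variable (hB : IsBialgebraInYD Q D)

theorem braid_tmul (hB : IsBialgebraInYD Q D) (a b : B) :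
    D.braid (a ⊗ₜ b) = ∑ κ, D.act (D.cm1 a κ) b ⊗ₜ[k] D.cm0 a κ := by
  simp [BialgData.braid_tmul_eq_rTensor, hB.coact_eq]

theorem braid_comm (h : H) :
    D.braid ∘ₗ Q.tensorAct hB.yd.actHom hB.yd.actHom h =
      Q.tensorAct hB.yd.actHom hB.yd.actHom h ∘ₗ D.braid := by
  refine TensorProduct.ext' fun a b => ?_
  have hL (j) (t : H ⊗[k] B) : (D.act.flip b).rTensor B
      (TensorProduct.map (LinearMap.mulLeft k (Q.Δ1 h j)) (D.act (Q.Δ2 h j)) t) =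
        TensorProduct.map (D.act (Q.Δ1 h j)) (D.act (Q.Δ2 h j)) ((D.act.flip b).rTensor B t) := by
    induction t <;> simp_all [hB.yd.mul_act]
  have hR (j) (t : H ⊗[k] B) : (D.act.flip b).rTensor B
      ((LinearMap.mulRight k (Q.Δ2 h j)).rTensor B t) =
        (D.act.flip (D.act (Q.Δ2 h j) b)).rTensor B t := by
    induction t <;> simp_all [hB.yd.mul_act]
  have := congrArg ((D.act.flip b).rTensor B) (hB.yd.yd3 h a)
  simp only [map_sum, hL, hR] at this
  simp only [QuasiBialgebra.tensorAct_apply, TensorProduct.map_tmul, LinearMap.comp_apply,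
    BialgData.braid_tmul_eq_rTensor, IsLeftYD.actHom_apply, map_sum, this]

/-- The map `b ⊗ b' ↦ b₍₋₁₎·b'₁ ⊗ (b₍₀₎ ⊗ b'₂)`, with the reassociators inserted. -/
def braidComul : B ⊗[k] B →ₗ[k] B ⊗[k] (B ⊗[k] B) :=
  (Q.associator hB.yd.actHom hB.yd.actHom hB.yd.actHom).toLinearMap ∘ₗ
    TensorProduct.map D.braid LinearMap.id ∘ₗ
      (Q.associator hB.yd.actHom hB.yd.actHom hB.yd.actHom).symm.toLinearMap ∘ₗ
        TensorProduct.map LinearMap.id D.comul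

theorem braidComul_tmul (h : H) (b b' : B) : hB.braidComul (b ⊗ₜ D.act h b') =
    ∑ j, ∑ l, ∑ a, ∑ κ, ∑ i,
      D.act (Q.X1 i * D.cm1 (D.act (Q.x1 a) b) κ * Q.x2 a * Q.Δ1 h j) (D.D1 b' l) ⊗ₜ[k]
        (D.act (Q.X2 i) (D.cm0 (D.act (Q.x1 a) b) κ) ⊗ₜ[k]
          D.act (Q.X3 i * Q.x3 a * Q.Δ2 h j) (D.D2 b' l)) := by
  simp only [braidComul, LinearMap.comp_apply, TensorProduct.map_tmul, hB.comul_act, hB.comul_eq,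
    map_sum, TensorProduct.tmul_sum, LinearEquiv.coe_coe, QuasiBialgebra.associator_symm_tmul,
    LinearMap.id_apply, IsLeftYD.actHom_apply, hB.braid_tmul, TensorProduct.sum_tmul,
    QuasiBialgebra.associator_tmul, hB.yd.mul_act]

set_option maxHeartbeats 400000 in
theorem diagAction_tmul (f : H →ₐ[k] Module.End k M) (r : M ⊗[k] B →ₗ[k] M) (μ : B ⊗[k] B →ₗ[k] B)
    (m : M) (b b' : B) :
    TensorProduct.map LinearMap.id μ (TensorProduct.map r LinearMap.id
      ((Q.associator f hB.yd.actHom (Q.tensorAct hB.yd.actHom hB.yd.actHom)).symm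
        (TensorProduct.map LinearMap.id hB.braidComul
          (Q.associator f hB.yd.actHom hB.yd.actHom ((m ⊗ₜ b) ⊗ₜ b'))))) =
    ∑ a, ∑ i, ∑ i2, ∑ a2, ∑ j, ∑ j2, ∑ l, ∑ κ,
      r (f (Q.x1 a * Q.X1 i) m ⊗ₜ
        D.act (Q.x2 a * Q.X1 i2 * D.cm1 (D.act (Q.x1 a2 * Q.X2 i) b) κ
              * Q.x2 a2 * Q.Δ1 (Q.X3 i) j) (D.D1 b' l)) ⊗ₜ[k]
      μ (D.act (Q.Δ1 (Q.x3 a) j2 * Q.X2 i2) (D.cm0 (D.act (Q.x1 a2 * Q.X2 i) b) κ) ⊗ₜ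
        D.act (Q.Δ2 (Q.x3 a) j2 * Q.X3 i2 * Q.x3 a2 * Q.Δ2 (Q.X3 i) j) (D.D2 b' l)) := by
  simp only [QuasiBialgebra.associator_tmul, map_sum, TensorProduct.map_tmul, LinearMap.id_apply,
    IsLeftYD.actHom_apply, hB.braidComul_tmul]
  simp only [TensorProduct.tmul_sum, map_sum, QuasiBialgebra.associator_symm_tmul]
  simp only [QuasiBialgebra.tensorAct_tmul, TensorProduct.tmul_sum, map_sum, TensorProduct.map_tmul,
    LinearMap.id_apply, IsLeftYD.actHom_apply]
  refine (sum_reorder _).trans ?_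
  refine Finset.sum_congr rfl fun a _ => Finset.sum_congr rfl fun i _ =>
    Finset.sum_congr rfl fun i2 _ => Finset.sum_congr rfl fun a2 _ =>
    Finset.sum_congr rfl fun j _ => Finset.sum_congr rfl fun j2 _ =>
    Finset.sum_congr rfl fun l _ => Finset.sum_congr rfl fun κ _ => ?_
  simp only [hB.yd.mul_act, map_mul, Module.End.mul_apply, LinearMap.comp_apply]

end IsBialgebraInYD
end Translation

section HopfModuleTranslation

variable {k H : Type} [Field k] [Ring H] [Algebra k H] {Q : QuasiBialgebra k H}
variable {B : Type} [AddCommGroup B] [Module k B] {D : BialgData Q B} {Sb : B →ₗ[k] B}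
variable {M : Type} [AddCommGroup M] [Module k M]

open QuasiBialgebra

namespace IsBialgebraInYD

variable (hB : IsBialgebraInYD Q D)

/-- The `H`-module underlying `B`. -/
abbrev obj : Q.Rep := ⟨B, hB.yd.actHom⟩

/-- The braiding of `B` with itself as a morphism. -/
def braidHom : hB.obj ⊗ hB.obj ⟶ hB.obj ⊗ hB.obj := ⟨D.braid, hB.braid_comm⟩

/-- The multiplication as a morphism. -/
def mulHom : hB.obj ⊗ hB.obj ⟶ hB.obj :=
  ⟨TensorProduct.lift D.mul, fun h => TensorProduct.ext' fun (a b : B) => by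
    change TensorProduct.lift D.mul (Q.tensorAct hB.yd.actHom hB.yd.actHom h (a ⊗ₜ b)) =
      D.act h (D.mul a b)
    simp [tensorAct_tmul, hB.act_mul]⟩

/-- The unit as a morphism. -/
def unitHom : 𝟙_ Q.Rep ⟶ hB.obj :=
  ⟨LinearMap.toSpanSingleton k B D.one, fun h => LinearMap.ext fun (c : k) => by
    change (Q.ε h * c) • D.one = D.act h (c • D.one)
    rw [map_smul, hB.act_one, smul_smul, mul_comm]⟩

/-- The comultiplication as a morphism. -/
def comulHom : hB.obj ⟶ hB.obj ⊗ hB.obj :=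
  ⟨D.comul, fun h => LinearMap.ext fun b => by
    change D.comul (D.act h b) = Q.tensorAct hB.yd.actHom hB.yd.actHom h (D.comul b)
    rw [hB.comul_act, tensorAct_apply]
    rfl⟩

/-- The counit as a morphism. -/
def counitHom : hB.obj ⟶ 𝟙_ Q.Rep := ⟨D.counit, fun h => LinearMap.ext (hB.counit_act h)⟩

theorem diagAction_toLin_tmul {V : Q.Rep} (μ : hB.obj ⊗ hB.obj ⟶ hB.obj) (r : V ⊗ hB.obj ⟶ V)
    (v : V.carrier) (b b' : B) :
    (diagAction hB.braidHom hB.comulHom μ r).toLin ((v ⊗ₜ[k] b) ⊗ₜ[k] b') =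
    ∑ a, ∑ i, ∑ i2, ∑ a2, ∑ j, ∑ j2, ∑ l, ∑ κ,
      r.toLin (V.act (Q.x1 a * Q.X1 i) v ⊗ₜ[k]
        D.act (Q.x2 a * Q.X1 i2 * D.cm1 (D.act (Q.x1 a2 * Q.X2 i) b) κ
              * Q.x2 a2 * Q.Δ1 (Q.X3 i) j) (D.D1 b' l)) ⊗ₜ[k]
      μ.toLin (D.act (Q.Δ1 (Q.x3 a) j2 * Q.X2 i2) (D.cm0 (D.act (Q.x1 a2 * Q.X2 i) b) κ) ⊗ₜ[k]
        D.act (Q.Δ2 (Q.x3 a) j2 * Q.X3 i2 * Q.x3 a2 * Q.Δ2 (Q.X3 i) j) (D.D2 b' l)) :=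
  hB.diagAction_tmul V.act r.toLin μ.toLin v b b'

end IsBialgebraInYD

/-- The antipode as a morphism. -/
def IsBraidedHopf.antipodeHom (hB : IsBraidedHopf Q D Sb) : hB.bialg.obj ⟶ hB.bialg.obj :=
  ⟨Sb, fun h => LinearMap.ext (hB.antipode_Hlinear h)⟩

namespace IsRightBHopfModule

variable {actM : H →ₗ[k] M →ₗ[k] M} {coactM : M →ₗ[k] H ⊗[k] M}
  {ract : B →ₗ[k] M →ₗ[k] M} {rcoact : M →ₗ[k] M ⊗[k] B}
  (hM : IsRightBHopfModule Q D actM coactM ract rcoact) (hB : IsBialgebraInYD Q D)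

/-- The `H`-module underlying `M`. -/
abbrev obj : Q.Rep := ⟨M, hM.yd.actHom⟩

/-- The `B`-action as a morphism. -/
def actHom : hM.obj ⊗ hB.obj ⟶ hM.obj :=
  ⟨TensorProduct.lift ract.flip, fun h => TensorProduct.ext' fun m b => by
    change TensorProduct.lift ract.flip (Q.tensorAct hM.yd.actHom hB.yd.actHom h (m ⊗ₜ b)) =
      actM h (ract b m)
    simp [tensorAct_tmul, hM.ract_Hlinear]⟩

/-- The `B`-coaction as a morphism. -/
def coactHom : hM.obj ⟶ hM.obj ⊗ hB.obj :=
  ⟨rcoact, fun h => LinearMap.ext fun m => by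
    change rcoact (actM h m) = Q.tensorAct hM.yd.actHom hB.yd.actHom h (rcoact m)
    rw [hM.rcoact_Hlinear, tensorAct_apply]
    rfl⟩

theorem mul_comul_hom :
    hB.mulHom ≫ hB.comulHom =
      hB.comulHom ▷ hB.obj ≫ diagAction hB.braidHom hB.comulHom hB.mulHom hB.mulHom := by
  refine QuasiBialgebra.Rep.hom_ext (TensorProduct.ext' fun b b' => ?_)
  change D.comul (D.mul b b') =
    (diagAction hB.braidHom hB.comulHom hB.mulHom hB.mulHom).toLin (D.comul b ⊗ₜ[k] b')
  rw [hB.comul_mul, hB.comul_eq b, TensorProduct.sum_tmul]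
  refine Eq.trans ?_ (map_sum _ _ _).symm
  rw [Finset.sum_congr rfl fun l _ =>
    hB.diagAction_toLin_tmul hB.mulHom hB.mulHom (D.D1 b l) (D.D2 b l) b']
  symm
  refine Finset.sum_comm.trans (Finset.sum_congr rfl fun a _ => ?_)
  refine Finset.sum_comm.trans (Finset.sum_congr rfl fun i _ => ?_)
  refine Finset.sum_comm.trans (Finset.sum_congr rfl fun i2 _ => ?_)
  refine Finset.sum_comm.trans (Finset.sum_congr rfl fun a2 _ => ?_)
  refine Finset.sum_comm.trans (Finset.sum_congr rfl fun j _ => ?_)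
  exact Finset.sum_comm

theorem coact_act_hom :
    hM.actHom hB ≫ hM.coactHom hB =
      hM.coactHom hB ▷ hB.obj ≫ diagAction hB.braidHom hB.comulHom hB.mulHom (hM.actHom hB) := by
  refine QuasiBialgebra.Rep.hom_ext (TensorProduct.ext' fun m b => ?_)
  change rcoact (ract b m) =
    (diagAction hB.braidHom hB.comulHom hB.mulHom (hM.actHom hB)).toLin (rcoact m ⊗ₜ[k] b)
  rw [hM.rcoact_ract]
  induction rcoact m with
  | zero => simp
  | add x y hx hy =>
    simp only [map_add, Finset.sum_add_distrib, hx, hy, TensorProduct.add_tmul]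
  | tmul m b' =>
    refine Eq.trans ?_ (hB.diagAction_toLin_tmul hB.mulHom (hM.actHom hB) m b' b).symm
    refine Finset.sum_congr rfl fun a _ => Finset.sum_congr rfl fun i _ =>
      Finset.sum_congr rfl fun i2 _ => Finset.sum_congr rfl fun a2 _ =>
      Finset.sum_congr rfl fun j _ => Finset.sum_congr rfl fun j2 _ =>
      Finset.sum_congr rfl fun l _ => ?_
    simp only [LinearMap.lTensor_tmul, LinearMap.comp_apply, hB.coact_eq, TensorProduct.tmul_sum,
      map_sum, TensorProduct.assoc_symm_tmul, TensorProduct.map_tmul, TensorProduct.lift.tmul,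
      LinearMap.flip_apply, lrH, LinearMap.mulLeft_apply, LinearMap.mulRight_apply, mul_assoc]
    rfl

theorem hopfModuleIn (hB : IsBraidedHopf Q D Sb) :
    HopfModuleIn hB.bialg.braidHom hB.bialg.mulHom hB.bialg.unitHom hB.bialg.comulHom
      hB.bialg.counitHom hB.antipodeHom (hM.actHom hB.bialg) (hM.coactHom hB.bialg) where
  unit_braid := by
    refine QuasiBialgebra.Rep.hom_ext (TensorProduct.ext' fun c b => ?_)
    change D.braid ((c • D.one) ⊗ₜ b) = (c • b) ⊗ₜ ((1 : k) • D.one)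
    rw [← TensorProduct.smul_tmul', map_smul, BialgData.braid_tmul_eq_rTensor, hB.bialg.coact_one]
    simp [hB.bialg.yd.one_act, TensorProduct.smul_tmul']
  one_mul := by
    refine QuasiBialgebra.Rep.hom_ext (TensorProduct.ext' fun c b => ?_)
    change TensorProduct.lift D.mul ((c • D.one) ⊗ₜ b) = c • b
    simp [hB.bialg.one_mul]
  counit_comul := by
    refine QuasiBialgebra.Rep.hom_ext (LinearMap.ext fun b => ?_)
    exact ((TensorProduct.lid k B).eq_symm_apply).2 (hB.bialg.comul_counit_left b)
  unit_comul := by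
    refine QuasiBialgebra.Rep.hom_ext (LinearMap.ext fun c => ?_)
    change D.comul (c • D.one) = ((1 : k) • D.one) ⊗ₜ (c • D.one)
    rw [map_smul, hB.bialg.comul_one]
    simp
  mul_comul := mul_comul_hom hB.bialg
  antipode_left := by
    refine QuasiBialgebra.Rep.hom_ext (LinearMap.ext fun b => ?_)
    change TensorProduct.lift D.mul (TensorProduct.map Sb LinearMap.id (D.comul b)) =
      D.counit b • D.one
    simp [hB.bialg.comul_eq, hB.antipode_left]
  antipode_right := by
    refine QuasiBialgebra.Rep.hom_ext (LinearMap.ext fun b => ?_)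
    change TensorProduct.lift D.mul (TensorProduct.map LinearMap.id Sb (D.comul b)) =
      D.counit b • D.one
    simp [hB.bialg.comul_eq, hB.antipode_right]
  act_assoc := by
    refine QuasiBialgebra.Rep.hom_ext (TensorProduct.ext_threefold fun m b b' => ?_)
    change ract b' (ract b m) = TensorProduct.lift ract.flip (TensorProduct.map LinearMap.id
      (TensorProduct.lift D.mul) (Q.associator _ _ _ ((m ⊗ₜ b) ⊗ₜ b')))
    simp [associator_tmul, hM.ract_assoc]
  act_unit := by
    refine QuasiBialgebra.Rep.hom_ext (TensorProduct.ext' fun m c => ?_)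
    change ract (c • D.one) m = c • m
    simp [hM.ract_one]
  coact_coassoc := by
    refine QuasiBialgebra.Rep.hom_ext (LinearMap.ext fun m => ?_)
    have := congrArg (TensorProduct.assoc k M B B) (hM.rcoact_coassoc m)
    rw [LinearEquiv.apply_symm_apply, map_sum] at this
    refine Eq.trans ?_ this
    change Q.associator hM.yd.actHom hB.bialg.yd.actHom hB.bialg.yd.actHom
      (rcoact.rTensor B (rcoact m)) = _
    induction rcoact.rTensor B (rcoact m) using TensorProduct.induction_on with
    | zero => simp
    | add x y hx hy => simp only [map_add, hx, hy, Finset.sum_add_distrib]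
    | tmul t b =>
      induction t with
      | zero => simp
      | add x y hx hy => simp only [TensorProduct.add_tmul, map_add, hx, hy, Finset.sum_add_distrib]
      | tmul m b' => simp [associator_tmul]
  coact_counit := by
    refine QuasiBialgebra.Rep.hom_ext (LinearMap.ext fun m => ?_)
    exact ((TensorProduct.rid k M).eq_symm_apply).2 (hM.rcoact_counit m)
  coact_act := hM.coact_act_hom hB.bialg

end IsRightBHopfModule
end HopfModuleTranslation

section Coinvariants

variable {k H : Type} [Field k] [Ring H] [Algebra k H] {Q : QuasiBialgebra k H}
variable {B : Type} [AddCommGroup B] [Module k B] {D : BialgData Q B} {Sb : B →ₗ[k] B}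
variable {M : Type} [AddCommGroup M] [Module k M]
variable {actM : H →ₗ[k] M →ₗ[k] M} {coactM : M →ₗ[k] H ⊗[k] M}
  {ract : B →ₗ[k] M →ₗ[k] M} {rcoact : M →ₗ[k] M ⊗[k] B}

theorem mem_coinvariants {m : M} : m ∈ coinvariants D rcoact ↔ rcoact m = m ⊗ₜ D.one := by
  simp [coinvariants, sub_eq_zero]

namespace IsRightBHopfModule

variable (hM : IsRightBHopfModule Q D actM coactM ract rcoact)

theorem act_mem_coinvariants (hM : IsRightBHopfModule Q D actM coactM ract rcoact)
    (hB : IsBialgebraInYD Q D) (h : H) {m : M}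
    (hm : m ∈ coinvariants D rcoact) : actM h m ∈ coinvariants D rcoact := by
  rw [mem_coinvariants] at hm ⊢
  conv_rhs => rw [← Q.counit_right h]
  simp [hM.rcoact_Hlinear, hm, hB.act_one, LinearMap.sum_apply, TensorProduct.sum_tmul,
    TensorProduct.smul_tmul]

/-- The coinvariants as an `H`-module. -/
abbrev coinvObj (hB : IsBialgebraInYD Q D) : Q.Rep :=
  ⟨coinvariants D rcoact, AlgHom.ofLinearMap
    { toFun := fun h => (actM h).restrict fun _ => hM.act_mem_coinvariants hB h
      map_add' := fun g h => by ext; simp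
      map_smul' := fun c h => by ext; simp }
    (by ext; simp [hM.yd.one_act]) (fun g h => by ext; simp [hM.yd.mul_act])⟩

/-- The inclusion of the coinvariants as a morphism. -/
def coinvHom (hB : IsBialgebraInYD Q D) : hM.coinvObj hB ⟶ hM.obj :=
  ⟨(coinvariants D rcoact).subtype, fun _ => rfl⟩

theorem tmulUnit_apply (hB : IsBialgebraInYD Q D) (m : M) :
    (HopfModuleIn.tmulUnit hM.obj hB.unitHom).toLin m = m ⊗ₜ[k] D.one := by
  change m ⊗ₜ[k] ((1 : k) • D.one) = _
  rw [one_smul]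

theorem coinvHom_coact (hB : IsBialgebraInYD Q D) :
    hM.coinvHom hB ≫ hM.coactHom hB =
      hM.coinvHom hB ≫ HopfModuleIn.tmulUnit hM.obj hB.unitHom := by
  refine QuasiBialgebra.Rep.hom_ext (LinearMap.ext fun (m : coinvariants D rcoact) => ?_)
  exact (mem_coinvariants.1 m.2).trans (hM.tmulUnit_apply hB m.1).symm

theorem proj_toLin (hB : IsBraidedHopf Q D Sb) :
    (HopfModuleIn.proj hB.antipodeHom (hM.actHom hB.bialg) (hM.coactHom hB.bialg)).toLin =
      coinvProj Sb ract rcoact := by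
  refine LinearMap.ext fun m => ?_
  change TensorProduct.lift ract.flip (TensorProduct.map LinearMap.id Sb (rcoact m)) =
    TensorProduct.lift (ract ∘ₗ Sb).flip (rcoact m)
  have : TensorProduct.lift ract.flip ∘ₗ TensorProduct.map LinearMap.id Sb =
      TensorProduct.lift (ract ∘ₗ Sb).flip := TensorProduct.ext' fun _ _ => rfl
  rw [← this]
  rfl

theorem coinvProj_mem (hM : IsRightBHopfModule Q D actM coactM ract rcoact)
    (hB : IsBraidedHopf Q D Sb) (m : M) :
    coinvProj Sb ract rcoact m ∈ coinvariants D rcoact := by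
  have h := LinearMap.congr_fun (congrArg QuasiBialgebra.Rep.Hom.toLin
    (hM.hopfModuleIn hB).proj_coinvariant) m
  rw [mem_coinvariants, ← hM.proj_toLin hB]
  exact h.trans (hM.tmulUnit_apply hB.bialg _)

theorem lift_coinvProj (hM : IsRightBHopfModule Q D actM coactM ract rcoact)
    (hB : IsBraidedHopf Q D Sb) (m : M) :
    TensorProduct.lift ract.flip ((coinvProj Sb ract rcoact).rTensor B (rcoact m)) = m := by
  rw [← hM.proj_toLin hB]
  exact LinearMap.congr_fun (congrArg QuasiBialgebra.Rep.Hom.toLin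
    (hM.hopfModuleIn hB).proj_act) m

theorem rTensor_coinvProj (hM : IsRightBHopfModule Q D actM coactM ract rcoact)
    (hB : IsBraidedHopf Q D Sb) (t : coinvariants D rcoact ⊗[k] B) :
    (coinvProj Sb ract rcoact).rTensor B (rcoact (TensorProduct.lift ract.flip
      ((coinvariants D rcoact).subtype.rTensor B t))) =
      (coinvariants D rcoact).subtype.rTensor B t := by
  rw [← hM.proj_toLin hB]
  exact LinearMap.congr_fun (congrArg QuasiBialgebra.Rep.Hom.toLin
    ((hM.hopfModuleIn hB).coinvariant_act_proj (hM.coinvHom_coact hB.bialg))) t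

theorem rcoact_ract_coinvariant (hM : IsRightBHopfModule Q D actM coactM ract rcoact)
    (hB : IsBraidedHopf Q D Sb) (w : coinvariants D rcoact) (b : B) :
    rcoact (ract b w) = ∑ a, ∑ l, (ract (D.act (Q.x2 a) (D.D1 b l)) (actM (Q.x1 a) (w : M)))
      ⊗ₜ[k] (D.act (Q.x3 a) (D.D2 b l)) := by
  have h := LinearMap.congr_fun (congrArg QuasiBialgebra.Rep.Hom.toLin
    ((hM.hopfModuleIn hB).coinvariant_act (hM.coinvHom_coact hB.bialg))) (w ⊗ₜ[k] b)
  refine h.trans ?_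
  change TensorProduct.map (TensorProduct.lift ract.flip) LinearMap.id
    ((Q.associator hM.yd.actHom hB.bialg.yd.actHom hB.bialg.yd.actHom).symm
      (TensorProduct.map LinearMap.id D.comul ((w : M) ⊗ₜ b))) = _
  simp only [TensorProduct.map_tmul, hB.bialg.comul_eq, TensorProduct.tmul_sum, map_sum,
    QuasiBialgebra.associator_symm_tmul, LinearMap.id_apply, TensorProduct.lift.tmul,
    IsLeftYD.actHom_apply, LinearMap.flip_apply]
  exact Finset.sum_comm

theorem coact_ract (hM : IsRightBHopfModule Q D actM coactM ract rcoact)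
    (hB : IsBialgebraInYD Q D) (m : M) (b : B) :
    coactM (ract b m) = ∑ i, ∑ a, ∑ i2,
      (TensorProduct.map (sandwichLift k (Q.X1 i) (Q.x2 a) (Q.X3 i2))
        (TensorProduct.lift
          (((ract.comp (D.act (Q.X3 i * Q.x3 a))).flip).comp (actM (Q.X2 i)))))
        ((TensorProduct.tensorTensorTensorComm k H M H B)
          ((coactM (actM (Q.x1 a * Q.X1 i2) m)) ⊗ₜ[k] (D.coact (D.act (Q.X2 i2) b)))) := by
  rw [hM.ract_Hcolinear]
  refine Finset.sum_congr rfl fun i _ => Finset.sum_congr rfl fun a _ =>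
    Finset.sum_congr rfl fun i2 _ => ?_
  rw [hB.coact_eq, TensorProduct.tmul_sum, map_sum, map_sum]
  refine Finset.sum_congr rfl fun κ _ => ?_
  induction coactM (actM (Q.x1 a * Q.X1 i2) m) with
  | zero => simp
  | add x y hx hy => simp only [map_add, TensorProduct.add_tmul, hx, hy]
  | tmul h m => simp [lrH, sandwichLift, mul_assoc]

end IsRightBHopfModule
end Coinvariants

/-- Theorem 4.3 (iv) (Structure Theorem for Hopf modules in the Yetter-Drinfeld
category): for a quasi-Hopf algebra `H`, a Hopf algebra `B` in the braided
category of left Yetter-Drinfeld modules over `H` and a right `B`-Hopf module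
`M`, the map `F : M^{co B} ⊗ B → M`, `F(n⊗b) = n←b`, is an isomorphism of right
`B`-Hopf modules (it is bijective, it intertwines the `H`-action, `H`-coaction,
`B`-action and `B`-coaction), with inverse `G(m) = ∑ P(m₍0₎) ⊗ m₍1₎` where
`P(m) = ∑ m₍0₎ ← S̲(m₍1₎)`. -/
theorem hopf_module_structure_theorem {k H : Type} [Field k] [Ring H] [Algebra k H]
    (Q : QuasiHopf k H) {B : Type} [AddCommGroup B] [Module k B]
    (D : BialgData Q.toQuasiBialgebra B) (Sb : B →ₗ[k] B)
    (hB : IsBraidedHopf Q.toQuasiBialgebra D Sb)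
    {M : Type} [AddCommGroup M] [Module k M]
    (actM : H →ₗ[k] M →ₗ[k] M) (coactM : M →ₗ[k] H ⊗[k] M)
    (ract : B →ₗ[k] M →ₗ[k] M) (rcoact : M →ₗ[k] M ⊗[k] B)
    (hM : IsRightBHopfModule Q.toQuasiBialgebra D actM coactM ract rcoact) :
    ∃ F : ((coinvariants D rcoact) ⊗[k] B) →ₗ[k] M,
      (∀ (w : coinvariants D rcoact) (b : B), F (w ⊗ₜ[k] b) = ract b (w : M)) ∧
      Function.Bijective F ∧
      (∃ G : M →ₗ[k] (coinvariants D rcoact) ⊗[k] B,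
        (∀ m, (LinearMap.rTensor B (coinvariants D rcoact).subtype) (G m)
            = (LinearMap.rTensor B (coinvProj Sb ract rcoact)) (rcoact m)) ∧
        (∀ m, F (G m) = m) ∧ (∀ t, G (F t) = t)) ∧
      (∀ (h : H) (w : coinvariants D rcoact) (b : B),
        actM h (F (w ⊗ₜ[k] b))
          = ∑ j, ract (D.act (Q.Δ2 h j) b) (actM (Q.Δ1 h j) (w : M))) ∧
      (∀ (w : coinvariants D rcoact) (b : B),
        coactM (F (w ⊗ₜ[k] b))
          = ∑ i, ∑ a, ∑ i2,
              (TensorProduct.map (sandwichLift k (Q.X1 i) (Q.x2 a) (Q.X3 i2))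
                (TensorProduct.lift
                  (((ract.comp (D.act (Q.X3 i * Q.x3 a))).flip).comp
                    (actM (Q.X2 i)))))
                ((TensorProduct.tensorTensorTensorComm k H M H B)
                  ((coactM (actM (Q.x1 a * Q.X1 i2) (w : M)))
                    ⊗ₜ[k] (D.coact (D.act (Q.X2 i2) b))))) ∧
      (∀ (w : coinvariants D rcoact) (b b' : B),
        ract b' (F (w ⊗ₜ[k] b))
          = ∑ i, ract (D.mul (D.act (Q.X2 i) b) (D.act (Q.X3 i) b'))
              (actM (Q.X1 i) (w : M))) ∧
      (∀ (w : coinvariants D rcoact) (b : B),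
        rcoact (F (w ⊗ₜ[k] b))
          = ∑ a, ∑ l, (ract (D.act (Q.x2 a) (D.D1 b l)) (actM (Q.x1 a) (w : M)))
              ⊗ₜ[k] (D.act (Q.x3 a) (D.D2 b l))) := by
  set N := coinvariants D rcoact
  let F : N ⊗[k] B →ₗ[k] M := TensorProduct.lift ract.flip ∘ₗ N.subtype.rTensor B
  let P : M →ₗ[k] N := (coinvProj Sb ract rcoact).codRestrict N (hM.coinvProj_mem hB)
  let G : M →ₗ[k] N ⊗[k] B := P.rTensor B ∘ₗ rcoact
  have hG m : N.subtype.rTensor B (G m) = (coinvProj Sb ract rcoact).rTensor B (rcoact m) := by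
    simp only [G, LinearMap.comp_apply, ← LinearMap.rTensor_comp_apply]
    rfl
  have hFG m : F (G m) = m := by
    rw [LinearMap.comp_apply, hG, hM.lift_coinvProj hB]
  have hGF t : G (F t) = t := by
    refine Module.Flat.rTensor_preserves_injective_linearMap N.subtype N.injective_subtype ?_
    rw [hG]
    exact hM.rTensor_coinvProj hB t
  exact ⟨F, fun _ _ => rfl,
    ⟨Function.LeftInverse.injective hGF, Function.RightInverse.surjective hFG⟩,
    ⟨G, hG, hFG, hGF⟩, fun h w b => hM.ract_Hlinear h b w, fun w b => hM.coact_ract hB.bialg w b,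
    fun w b b' => hM.ract_assoc w b b', fun w b => hM.rcoact_ract_coinvariant hB w b⟩
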